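/- arXiv:1407.2109 — 9 statements merged into one kernel-verified Lean document; each statement's English description precedes it below -/
import Mathlib

section
/- Let G be a finite simple graph on vertex set V, let H be a spanning subgraph of G, let t be a positive integer, and let α ∈ (0,1]. Suppose that for every vertex v ∈ V, either deg_H(v) = 0 or deg_H(v) ≥ α·deg_G(v). Let W_H be the set of all walks of length t in H that detect an odd cycle. Then ∑_{w ∈ W_H} P_G(w) ≥ α^t · ∑_{w ∈ W_H} P_H(w); in particular, since every walk in H is also a walk in G, the probability that a t-step random walk in G detects an odd cycle is at least α^t times the probability that a t-step random walk in H detects an odd cycle. -/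
open scoped Classical

noncomputable section

/-- `walkProb K w` is the probability that a random walk in the graph `K` (starting at a
uniformly random vertex of `V` and moving to a uniformly random neighbor at each step)
traverses exactly the vertex sequence of the walk `w`, namely
`(1/|V|) · ∏_{i=0}^{t-1} 1/deg_K(v_i)` where `w = (v₀, …, v_t)`. -/
def walkProb {V : Type*} [Fintype V] (K : SimpleGraph V) {H : SimpleGraph V} {u v : V}
    (w : H.Walk u v) : ℝ :=
  (1 / (Fintype.card V : ℝ)) * (w.support.dropLast.map fun x => ((K.degree x : ℝ))⁻¹).prod

/-- A walk detects an odd cycle if the subgraph consisting of the edges it traverses is not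
bipartite (not 2-colorable). -/
def DetectsOddCycle {V : Type*} {H : SimpleGraph V} {u v : V} (w : H.Walk u v) : Prop :=
  ¬ (SimpleGraph.fromEdgeSet {e : Sym2 V | e ∈ w.edges}).Colorable 2

theorem walk_aux {V : Type*} [Fintype V] (G H : SimpleGraph V) (hHG : H ≤ G) (α : ℝ) (hα0 : 0 < α)
    (hdeg : ∀ v : V, H.degree v = 0 ∨ α * (G.degree v : ℝ) ≤ (H.degree v : ℝ))
    {u v : V} (p : H.Walk u v) :
    α ^ p.length * (p.support.dropLast.map fun x => ((H.degree x : ℝ))⁻¹).prod ≤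
      (p.support.dropLast.map fun x => ((G.degree x : ℝ))⁻¹).prod := by
  induction p with
  | nil => simp
  | @cons u v w h p ih =>
    have hH : 0 < H.degree u := (H.degree_pos_iff_exists_adj u).2 ⟨v, h⟩
    have hG : 0 < G.degree u := (G.degree_pos_iff_exists_adj u).2 ⟨v, hHG h⟩
    have hd := (hdeg u).resolve_left hH.ne'
    have hH' : (0 : ℝ) < H.degree u := by exact_mod_cast hH
    have hG' : (0 : ℝ) < G.degree u := by exact_mod_cast hG
    have key : α * (H.degree u : ℝ)⁻¹ ≤ (G.degree u : ℝ)⁻¹ := by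
      rw [← div_eq_mul_inv, div_le_iff₀ hH', inv_mul_eq_div, le_div_iff₀ hG']
      exact hd
    have hnn : 0 ≤ (p.support.dropLast.map fun x => ((H.degree x : ℝ))⁻¹).prod := by
      apply List.prod_nonneg
      intro a ha
      obtain ⟨x, -, rfl⟩ := List.mem_map.1 ha
      positivity
    rw [SimpleGraph.Walk.support_cons, List.dropLast_cons_of_ne_nil p.support_ne_nil,
      List.map_cons, List.map_cons, List.prod_cons, List.prod_cons, SimpleGraph.Walk.length_cons]
    calc _ = (α * (H.degree u : ℝ)⁻¹) *
          (α ^ p.length * (p.support.dropLast.map fun x => ((H.degree x : ℝ))⁻¹).prod) := by ring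
      _ ≤ _ := mul_le_mul key ih (mul_nonneg (pow_nonneg hα0.le _) hnn) (by positivity)

/-- Let `G` be a finite simple graph on `V`, `H` a spanning subgraph of `G`,
`t` a positive integer and `α ∈ (0,1]`. Suppose every vertex `v` satisfies `deg_H v = 0` or
`deg_H v ≥ α · deg_G v`. Let `W_H` be the set of all walks of length `t` in `H` that detect an
odd cycle. Then `∑_{w ∈ W_H} P_G(w) ≥ α^t · ∑_{w ∈ W_H} P_H(w)`; in particular the probability
that a `t`-step random walk in `G` detects an odd cycle is at least `α^t` times the
corresponding probability for `H`. -/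
theorem stmt_0 {V : Type*} [Fintype V] [DecidableEq V]
    (G H : SimpleGraph V) (hHG : H ≤ G)
    (t : ℕ) (ht : 0 < t) (α : ℝ) (hα0 : 0 < α) (hα1 : α ≤ 1)
    (hdeg : ∀ v : V, H.degree v = 0 ∨ α * (G.degree v : ℝ) ≤ (H.degree v : ℝ)) :
    α ^ t *
        ∑ w ∈ Finset.univ.filter
            (fun w : Σ u : V, Σ v : V, {p : H.Walk u v // p.length = t} =>
              DetectsOddCycle w.2.2.1),
          walkProb H w.2.2.1 ≤
      ∑ w ∈ Finset.univ.filter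
          (fun w : Σ u : V, Σ v : V, {p : H.Walk u v // p.length = t} =>
            DetectsOddCycle w.2.2.1),
        walkProb G w.2.2.1 := by
  rw [Finset.mul_sum]
  refine Finset.sum_le_sum fun w _ => ?_
  obtain ⟨u, v, p, rfl⟩ := w
  have h := walk_aux G H hHG α hα0 (fun v => by convert hdeg v) p
  unfold walkProb
  rw [mul_left_comm]
  exact mul_le_mul_of_nonneg_left h (by positivity)
end
end

section
/- Let G be a finite simple graph and let H be a connected subgraph of G with at least one vertex such that H is not bipartite and such that any two vertices of H are at graph distance at most D in G. Then G contains a cycle of odd length at most 2D + 1. -/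
theorem aux_split {V : Type*} {G : SimpleGraph V} {u v : V} (p : G.Walk u v) (hp : ¬ p.IsPath) :
    ∃ (x : V) (c : G.Walk x x) (r : G.Walk u v), 0 < c.length ∧ c.length + r.length = p.length := by
  classical
  induction p with
  | nil => simp at hp
  | @cons a b d h p ih =>
    by_cases h1 : p.IsPath
    · have h2 : a ∈ p.support := by
        by_contra h3
        exact hp ((SimpleGraph.Walk.cons_isPath_iff h p).2 ⟨h1, h3⟩)
      refine ⟨a, SimpleGraph.Walk.cons h (p.takeUntil a h2), p.dropUntil a h2, by simp, ?_⟩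
      have := congrArg SimpleGraph.Walk.length (p.take_spec h2)
      rw [SimpleGraph.Walk.length_append] at this
      simp only [SimpleGraph.Walk.length_cons]
      omega
    · obtain ⟨x, c, r, h3, h4⟩ := ih h1
      refine ⟨x, c, SimpleGraph.Walk.cons h r, h3, ?_⟩
      simp only [SimpleGraph.Walk.length_cons]
      omega

theorem aux_cycle {V : Type*} {G : SimpleGraph V} (n : ℕ) : ∀ (u : V) (w : G.Walk u u),
    w.length = n → Odd n →
    ∃ (x : V) (c : G.Walk x x), c.IsCycle ∧ Odd c.length ∧ c.length ≤ n := by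
  induction n using Nat.strong_induction_on with
  | _ n ih =>
    intro u w hw hn
    cases w with
    | nil => simp at hw; subst hw; simp at hn
    | @cons _ b _ h q =>
      rw [SimpleGraph.Walk.length_cons] at hw
      by_cases hq : q.IsPath
      · refine ⟨u, SimpleGraph.Walk.cons h q, ?_, by simpa [hw] using hn, by simp [hw]⟩
        rw [SimpleGraph.Walk.isCycle_iff_isPath_tail_and_le_length]
        refine ⟨by simpa using hq, ?_⟩
        have h0 : q.length ≠ 0 := fun h0 => h.ne (SimpleGraph.Walk.eq_of_length_eq_zero h0).symm
        rw [SimpleGraph.Walk.length_cons]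
        obtain ⟨k, hk⟩ := hn
        omega
      · obtain ⟨x, c, r, h3, h4⟩ := aux_split q hq
        rcases Nat.even_or_odd c.length with he | ho
        · have h5 : (SimpleGraph.Walk.cons h r).length = r.length + 1 := by simp
          obtain ⟨y, d, h6, h7, h8⟩ := ih (r.length + 1) (by omega) u _ h5 (by
            obtain ⟨k, hk⟩ := hn
            obtain ⟨l, hl⟩ := he
            exact ⟨k - l, by omega⟩)
          exact ⟨y, d, h6, h7, by omega⟩
        · obtain ⟨y, d, h6, h7, h8⟩ := ih c.length (by omega) x c rfl ho
          exact ⟨y, d, h6, h7, by omega⟩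

/-- If a finite simple graph `G` has a connected subgraph `H` (with at least
one vertex) that is not bipartite and whose vertices are pairwise at graph distance at most `D`
in `G`, then `G` contains a cycle of odd length at most `2D + 1`. -/
theorem stmt_4 {V : Type*} [Fintype V] (G : SimpleGraph V) (H : G.Subgraph)
    (hne : H.verts.Nonempty) (hconn : H.Connected)
    (hnotbip : ¬ H.coe.Colorable 2) (D : ℕ)
    (hdist : ∀ x ∈ H.verts, ∀ y ∈ H.verts, G.dist x y ≤ D) :
    ∃ (x : V) (c : G.Walk x x), c.IsCycle ∧ Odd c.length ∧ c.length ≤ 2 * D + 1 := by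
  classical
  obtain ⟨r, hr⟩ := hne
  have hreach : ∀ v : H.verts, G.Reachable r v := fun v =>
    (hconn.coe.preconnected ⟨r, hr⟩ v).map H.hom
  by_contra hno
  apply hnotbip
  refine ⟨SimpleGraph.Coloring.mk (fun v => Fin.ofNat 2 (G.dist r v)) ?_⟩
  intro a b hab heq
  have hadj : G.Adj (a : V) b := H.adj_sub hab
  have hm : G.dist r a % 2 = G.dist r b % 2 := by simpa [Fin.ext_iff] using heq
  obtain ⟨p, hp⟩ := (hreach a).exists_walk_length_eq_dist
  obtain ⟨q, hq⟩ := (hreach b).exists_walk_length_eq_dist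
  have h1 := SimpleGraph.dist_le (p.concat hadj)
  have h2 := SimpleGraph.dist_le (q.concat hadj.symm)
  rw [SimpleGraph.Walk.length_concat] at h1 h2
  have h3 := hdist r hr a a.2
  have hl : ((p.concat hadj).append q.reverse).length = 2 * G.dist r a + 1 := by
    rw [SimpleGraph.Walk.length_append, SimpleGraph.Walk.length_concat,
      SimpleGraph.Walk.length_reverse]
    omega
  obtain ⟨x, c, h4, h5, h6⟩ := aux_cycle _ r _ hl ⟨_, rfl⟩
  exact hno ⟨x, c, h4, h5, by omega⟩
end

section
/- Let δ > 0 and let G = (V, E) be a finite simple graph that is δ-far from bipartite. Suppose there is a set F ⊆ E with |F| ≤ δ·|V| such that in the graph H = (V, E \ F), any two vertices lying in the same connected component of H are at graph distance at most D in G. Then G contains a cycle of odd length at most 2D + 1. -/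
/-- A finite simple graph `G` is `ε`-far from bipartite if every set `F` of edges of `G`
whose removal makes `G` bipartite (2-colorable) satisfies `|F| > ε · |V|`. -/
def FarFromBipartite {V : Type*} [Fintype V] (ε : ℝ) (G : SimpleGraph V) : Prop :=
  ∀ F : Finset (Sym2 V), ↑F ⊆ G.edgeSet → (G.deleteEdges ↑F).Colorable 2 →
    ε * (Fintype.card V : ℝ) < (F.card : ℝ)

theorem exists_path_same_parity {V : Type*} (G : SimpleGraph V) (N : ℕ)
    (hno : ∀ (x : V) (c : G.Walk x x), c.IsCycle → Odd c.length → ¬ c.length ≤ N)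
    {u v : V} (p : G.Walk u v) (hp : p.length ≤ N) :
    ∃ q : G.Walk u v, q.IsPath ∧ q.length ≤ p.length ∧ (Odd q.length ↔ Odd p.length) := by
  classical
  induction p with
  | nil => exact ⟨SimpleGraph.Walk.nil, by simp, by simp, by simp⟩
  | @cons u v w h p ih =>
    rw [SimpleGraph.Walk.length_cons] at hp
    obtain ⟨q, hq, hql, hqo⟩ := ih (by omega)
    by_cases hu : u ∈ q.support
    · have hlen := congrArg SimpleGraph.Walk.length (q.take_spec hu)
      rw [SimpleGraph.Walk.length_append] at hlen
      have hodd : Odd (q.takeUntil u hu).length := by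
        by_contra hne
        rw [Nat.not_odd_iff_even] at hne
        have h0 : (q.takeUntil u hu).length ≠ 0 := fun h0 =>
          h.ne (SimpleGraph.Walk.eq_of_length_eq_zero h0).symm
        have hpt := hq.takeUntil hu
        refine hno u (SimpleGraph.Walk.cons h (q.takeUntil u hu)) ?_ ?_ ?_
        · rw [SimpleGraph.Walk.isCycle_iff_isPath_tail_and_le_length]
          refine ⟨by simpa using hpt, ?_⟩
          rw [SimpleGraph.Walk.length_cons]
          obtain ⟨k, hk⟩ := hne
          omega
        · rw [SimpleGraph.Walk.length_cons]
          exact hne.add_one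
        · rw [SimpleGraph.Walk.length_cons]
          omega
      refine ⟨q.dropUntil u hu, hq.dropUntil hu, ?_, ?_⟩
      · rw [SimpleGraph.Walk.length_cons]; omega
      · rw [SimpleGraph.Walk.length_cons]
        simp only [Nat.odd_iff] at *
        omega
    · refine ⟨SimpleGraph.Walk.cons h q, hq.cons hu, ?_, ?_⟩
      · simp only [SimpleGraph.Walk.length_cons]; omega
      · simp only [SimpleGraph.Walk.length_cons, Nat.odd_iff] at *
        omega

/-- Let `δ > 0` and let `G` be a finite simple graph that is `δ`-far from
bipartite. If there is a set `F` of at most `δ·|V|` edges of `G` such that any two vertices in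
the same connected component of `G − F` are at graph distance at most `D` in `G`, then `G`
contains a cycle of odd length at most `2D + 1`. -/
theorem stmt_5 {V : Type*} [Fintype V] (δ : ℝ) (hδ : 0 < δ) (G : SimpleGraph V)
    (hfar : FarFromBipartite δ G)
    (F : Finset (Sym2 V)) (hFE : ↑F ⊆ G.edgeSet)
    (hFcard : (F.card : ℝ) ≤ δ * (Fintype.card V : ℝ))
    (D : ℕ)
    (hdist : ∀ x y : V, (G.deleteEdges ↑F).Reachable x y → G.dist x y ≤ D) :
    ∃ (x : V) (c : G.Walk x x), c.IsCycle ∧ Odd c.length ∧ c.length ≤ 2 * D + 1 := by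
  classical
  by_contra hcon
  push Not at hcon
  have hno : ∀ (x : V) (c : G.Walk x x), c.IsCycle → Odd c.length → ¬ c.length ≤ 2 * D + 1 :=
    fun x c h1 h2 => not_le.mpr (hcon x c h1 h2)
  refine absurd (hfar F hFE ?_) (not_lt.mpr hFcard)
  let H := G.deleteEdges (F : Set (Sym2 V))
  have hHG : H ≤ G := SimpleGraph.deleteEdges_le _
  let r : V → V := fun v => (H.connectedComponentMk v).out
  have hr : ∀ v, H.Reachable (r v) v := fun v =>
    SimpleGraph.ConnectedComponent.exact (Quot.out_eq (H.connectedComponentMk v))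
  refine ⟨SimpleGraph.Coloring.mk
    (fun v => (⟨G.dist (r v) v % 2, Nat.mod_lt _ (by norm_num)⟩ : Fin 2)) ?_⟩
  intro u v huv heq
  have huv' : H.Adj u v := huv
  have hrr : r u = r v := by
    have : H.connectedComponentMk u = H.connectedComponentMk v :=
      SimpleGraph.ConnectedComponent.sound huv'.reachable
    simp only [r, this]
  have hmod : G.dist (r u) u % 2 = G.dist (r v) v % 2 := congrArg Fin.val heq
  have h1 := hr u
  have h2 := hr v
  rw [← hrr] at h2 hmod
  obtain ⟨p, hp⟩ := (h1.mono hHG).exists_walk_length_eq_dist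
  obtain ⟨q, hq⟩ := (h2.mono hHG).exists_walk_length_eq_dist
  have d1 := hdist _ _ h1
  have d2 := hdist _ _ h2
  have hlen : (p.append (SimpleGraph.Walk.cons (hHG huv') q.reverse)).length
      = G.dist (r u) u + (G.dist (r u) v + 1) := by
    rw [SimpleGraph.Walk.length_append, SimpleGraph.Walk.length_cons,
      SimpleGraph.Walk.length_reverse, hp, hq]
  obtain ⟨w, hw, -, hwo⟩ := exists_path_same_parity G (2 * D + 1) hno
    (p.append (SimpleGraph.Walk.cons (hHG huv') q.reverse)) (by rw [hlen]; omega)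
  rw [hlen, (SimpleGraph.Walk.isPath_iff_nil.mp hw).eq_nil, SimpleGraph.Walk.length_nil,
    Nat.odd_iff, Nat.odd_iff] at hwo
  omega
end

section
/- Let ε > 0, let k ≥ 3 be an integer, and let G = (V, E) be a finite simple graph that is ε-far from bipartite. Suppose that every spanning subgraph of G that is (ε/2)-far from bipartite contains a cycle of odd length at most k. Then G contains at least ε·|V|/(2k) pairwise edge-disjoint cycles of odd length, each of length at most k. -/
/-- Let `ε > 0`, `k ≥ 3`, and let `G` be a finite simple graph that is `ε`-far
from bipartite. If every spanning subgraph of `G` that is `(ε/2)`-far from bipartite contains a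
cycle of odd length at most `k`, then `G` contains at least `ε·|V|/(2k)` pairwise edge-disjoint
cycles of odd length, each of length at most `k`. -/
theorem stmt_6 {V : Type*} [Fintype V] [DecidableEq V]
    (ε : ℝ) (hε : 0 < ε) (k : ℕ) (hk : 3 ≤ k)
    (G : SimpleGraph V) (hfar : FarFromBipartite ε G)
    (hsub : ∀ G' : SimpleGraph V, G' ≤ G → FarFromBipartite (ε / 2) G' →
      ∃ (x : V) (c : G'.Walk x x), c.IsCycle ∧ Odd c.length ∧ c.length ≤ k) :
    ∃ S : Finset (Σ x : V, G.Walk x x),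
      (∀ c ∈ S, c.2.IsCycle ∧ Odd c.2.length ∧ c.2.length ≤ k) ∧
      (∀ c ∈ S, ∀ d ∈ S, c ≠ d → ∀ e ∈ c.2.edges, e ∉ d.2.edges) ∧
      ε * (Fintype.card V : ℝ) / (2 * k) ≤ (S.card : ℝ) := by
  classical
  by_contra hcon
  push Not at hcon
  have key : ∀ n : ℕ, ∃ S : Finset (Σ x : V, G.Walk x x),
      (∀ c ∈ S, c.2.IsCycle ∧ Odd c.2.length ∧ c.2.length ≤ k) ∧
      (∀ c ∈ S, ∀ d ∈ S, c ≠ d → ∀ e ∈ c.2.edges, e ∉ d.2.edges) ∧ S.card = n := by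
    intro n
    induction n with
    | zero => exact ⟨∅, by simp, by simp, by simp⟩
    | succ n ih =>
      obtain ⟨S, h1, h2, h3⟩ := ih
      have hlt := hcon S h1 h2
      let F : Finset (Sym2 V) := S.biUnion (fun c => c.2.edges.toFinset)
      have hF : F.card ≤ S.card * k := by
        apply Finset.card_biUnion_le_card_mul
        intro c hc
        refine (List.toFinset_card_le _).trans ?_
        rw [SimpleGraph.Walk.length_edges]
        exact (h1 c hc).2.2
      have hFG : (F : Set (Sym2 V)) ⊆ G.edgeSet := by
        intro e he
        simp only [F, Finset.coe_biUnion, Set.mem_iUnion, Finset.mem_coe, List.mem_toFinset] at he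
        obtain ⟨c, _, hce⟩ := he
        exact c.2.edges_subset_edgeSet hce
      have hle : G.deleteEdges (F : Set (Sym2 V)) ≤ G := SimpleGraph.deleteEdges_le _
      have hkpos : (0 : ℝ) < 2 * k := by positivity
      have hFR : (F.card : ℝ) < ε * (Fintype.card V : ℝ) / 2 := by
        have hF' : (F.card : ℝ) ≤ S.card * k := by exact_mod_cast hF
        rw [lt_div_iff₀ hkpos] at hlt
        linarith
      obtain ⟨x, c, hc, hodd, hlen⟩ := hsub (G.deleteEdges (F : Set (Sym2 V))) hle (by
        intro F' hF' hcol
        have := hfar (F ∪ F') (by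
          rw [Finset.coe_union]
          exact Set.union_subset hFG (hF'.trans (SimpleGraph.edgeSet_mono hle))) (by
          rw [Finset.coe_union, ← SimpleGraph.deleteEdges_deleteEdges]
          exact hcol)
        have h4 : ((F ∪ F').card : ℝ) ≤ F.card + F'.card := by
          exact_mod_cast Finset.card_union_le F F'
        linarith)
      have hnot : ∀ e ∈ (c.mapLe hle).edges, e ∉ F := by
        intro e he
        rw [SimpleGraph.Walk.edges_mapLe_eq_edges] at he
        have := c.edges_subset_edgeSet he
        rw [SimpleGraph.edgeSet_deleteEdges] at this
        exact this.2
      have hinF : ∀ d ∈ S, ∀ e ∈ d.2.edges, e ∈ F := by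
        intro d hd e he
        exact Finset.mem_biUnion.2 ⟨d, hd, List.mem_toFinset.2 he⟩
      have hlen' : (c.mapLe hle).length = c.length := by simp [SimpleGraph.Walk.mapLe]
      have hnew : (⟨x, c.mapLe hle⟩ : Σ x : V, G.Walk x x) ∉ S := by
        intro hmem
        have hpos : 0 < (c.mapLe hle).edges.length := by
          rw [SimpleGraph.Walk.length_edges, hlen']
          exact hodd.pos
        obtain ⟨e, he⟩ := List.exists_mem_of_length_pos hpos
        exact hnot e he (hinF _ hmem e he)
      refine ⟨insert ⟨x, c.mapLe hle⟩ S, ?_, ?_, ?_⟩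
      · intro d hd
        rcases Finset.mem_insert.1 hd with rfl | hd
        · exact ⟨hc.mapLe hle, by simpa only [hlen'] using hodd, by simpa only [hlen'] using hlen⟩
        · exact h1 d hd
      · intro a ha b hb hab e hea heb
        rcases Finset.mem_insert.1 ha with rfl | ha <;> rcases Finset.mem_insert.1 hb with rfl | hb
        · exact hab rfl
        · exact hnot e hea (hinF _ hb e heb)
        · exact hnot e heb (hinF _ ha e hea)
        · exact h2 a ha b hb hab e hea heb
      · rw [Finset.card_insert_of_notMem hnew, h3]
  obtain ⟨n, hn⟩ := exists_nat_ge (ε * (Fintype.card V : ℝ) / (2 * k))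
  obtain ⟨S, h1, h2, h3⟩ := key n
  have := hcon S h1 h2
  rw [h3] at this
  linarith
end

section
/- Let ε ∈ (0,1), let D be a positive integer, and let G = (V, E) be a finite simple graph that is ε-far from bipartite. Suppose that for every spanning subgraph G' = (V, E') of G there exists a set F ⊆ E' with |F| ≤ (ε/2)·|V| such that any two vertices lying in the same connected component of (V, E' \ F) are at graph distance at most D in G'. Then G contains at least ε·|V|/(2(2D+1)) pairwise edge-disjoint cycles of odd length, each of length at most 2D + 1. -/
theorem aux_path_or_cycle {V : Type*} [DecidableEq V] {G : SimpleGraph V} {u v : V}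
    (p : G.Walk u v) :
    (∃ (x : V) (c : G.Walk x x), c.IsCycle ∧ Odd c.length ∧ c.length ≤ p.length) ∨
    ∃ q : G.Walk u v, q.IsPath ∧ q.length ≤ p.length ∧ (Odd q.length ↔ Odd p.length) := by
  induction p with
  | nil => exact Or.inr ⟨.nil, by simp, by simp, by simp⟩
  | @cons u x v h p ih =>
    rcases ih with ⟨y, c, h1, h2, h3⟩ | ⟨q, h1, h2, h3⟩
    · exact Or.inl ⟨y, c, h1, h2, by simp; omega⟩
    by_cases hu : u ∈ q.support
    · have hlen : (q.takeUntil u hu).length + (q.dropUntil u hu).length = q.length := by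
        rw [← SimpleGraph.Walk.length_append, SimpleGraph.Walk.take_spec]
      have ht := h1.takeUntil hu
      have hd := h1.dropUntil hu
      generalize q.takeUntil u hu = t at *
      generalize q.dropUntil u hu = d at *
      by_cases hodd : Odd t.length
      · refine Or.inr ⟨d, hd, by simp; omega, ?_⟩
        simp only [SimpleGraph.Walk.length_cons]
        grind
      · refine Or.inl ⟨u, .cons h t, ?_, ?_, by simp; omega⟩
        · rw [SimpleGraph.Walk.cons_isCycle_iff]
          refine ⟨ht, fun hm => ?_⟩
          cases t with
          | nil => exact h.ne rfl
          | @cons _ z _ h' r =>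
            rw [SimpleGraph.Walk.cons_isPath_iff] at ht
            rw [SimpleGraph.Walk.edges_cons, List.mem_cons] at hm
            rcases hm with hm | hm
            · have : z = u := by
                have := h.ne
                have := h'.ne
                simp at hm
                grind
              subst this
              have := SimpleGraph.Walk.isPath_iff_eq_nil |>.1 ht.1
              subst this
              simp at hodd
            · exact ht.2 (SimpleGraph.Walk.snd_mem_support_of_mem_edges _ hm)
        · simp only [SimpleGraph.Walk.length_cons]
          grind
    · refine Or.inr ⟨.cons h q, ?_, by simp; omega, ?_⟩
      · rw [SimpleGraph.Walk.cons_isPath_iff]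
        exact ⟨h1, hu⟩
      · simp only [SimpleGraph.Walk.length_cons]
        grind

theorem aux_odd_cycle {V : Type*} [DecidableEq V] {G : SimpleGraph V} {u : V}
    (p : G.Walk u u) (hp : Odd p.length) :
    ∃ (x : V) (c : G.Walk x x), c.IsCycle ∧ Odd c.length ∧ c.length ≤ p.length := by
  rcases aux_path_or_cycle p with h | ⟨q, h1, h2, h3⟩
  · exact h
  · have := SimpleGraph.Walk.isPath_iff_eq_nil |>.1 h1
    subst this
    simp at h3
    grind

theorem aux_short {V : Type*} [DecidableEq V] (H K : SimpleGraph V) (hle : K ≤ H) (D : ℕ)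
    (hd : ∀ x y : V, K.Reachable x y → H.dist x y ≤ D) (hK : ¬ K.Colorable 2) :
    ∃ (x : V) (c : H.Walk x x), c.IsCycle ∧ Odd c.length ∧ c.length ≤ 2 * D + 1 := by
  by_contra hno
  apply hK
  let r : V → V := fun v => (K.connectedComponentMk v).out
  have hr : ∀ v, K.Reachable (r v) v := fun v =>
    SimpleGraph.ConnectedComponent.exact (Quot.out_eq (K.connectedComponentMk v))
  have hcol : ∀ {a b : V}, K.Adj a b →
      decide (Even (H.dist (r a) a)) ≠ decide (Even (H.dist (r b) b)) := by
    intro a b hab heq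
    have hrr : r a = r b := by
      simp only [r]
      rw [SimpleGraph.ConnectedComponent.sound hab.reachable]
    apply hno
    obtain ⟨p, hp⟩ := ((hr a).mono hle).exists_walk_length_eq_dist
    obtain ⟨q, hq⟩ := ((hr b).mono hle).exists_walk_length_eq_dist
    have hpa := hd _ _ (hr a)
    have hqb := hd _ _ (hr b)
    have heq' : Even p.length ↔ Even q.length := by
      rw [hp, hq]; simpa using heq
    rw [← hp] at hpa
    rw [← hq] at hqb
    clear hp hq heq
    generalize r a = z at *
    subst hrr
    obtain ⟨x, c, h1, h2, h3⟩ := aux_odd_cycle (p.append (.cons (hle hab) q.reverse)) (by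
      simp only [SimpleGraph.Walk.length_append, SimpleGraph.Walk.length_cons,
        SimpleGraph.Walk.length_reverse]
      grind)
    refine ⟨x, c, h1, h2, h3.trans ?_⟩
    simp only [SimpleGraph.Walk.length_append, SimpleGraph.Walk.length_cons,
        SimpleGraph.Walk.length_reverse]
    omega
  have C : K.Coloring Bool := SimpleGraph.Coloring.mk _ hcol
  simpa using C.colorable

/-- Let `ε ∈ (0,1)`, let `D` be a positive integer, and let `G` be a finite
simple graph that is `ε`-far from bipartite. Suppose every spanning subgraph `G'` of `G` admits
a set `F` of at most `(ε/2)·|V|` of its edges such that any two vertices in the same connected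
component of `G' − F` are at graph distance at most `D` in `G'`. Then `G` contains at least
`ε·|V|/(2(2D+1))` pairwise edge-disjoint cycles of odd length, each of length at most `2D+1`. -/
theorem stmt_7 {V : Type*} [Fintype V] [DecidableEq V]
    (ε : ℝ) (hε0 : 0 < ε) (hε1 : ε < 1) (D : ℕ) (hD : 0 < D)
    (G : SimpleGraph V) (hfar : FarFromBipartite ε G)
    (hsub : ∀ G' : SimpleGraph V, G' ≤ G →
      ∃ F : Finset (Sym2 V), ↑F ⊆ G'.edgeSet ∧
        (F.card : ℝ) ≤ ε / 2 * (Fintype.card V : ℝ) ∧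
        ∀ x y : V, (G'.deleteEdges ↑F).Reachable x y → G'.dist x y ≤ D) :
    ∃ S : Finset (Σ x : V, G.Walk x x),
      (∀ c ∈ S, c.2.IsCycle ∧ Odd c.2.length ∧ c.2.length ≤ 2 * D + 1) ∧
      (∀ c ∈ S, ∀ d ∈ S, c ≠ d → ∀ e ∈ c.2.edges, e ∉ d.2.edges) ∧
      ε * (Fintype.card V : ℝ) / (2 * (2 * D + 1)) ≤ (S.card : ℝ) := by
  classical
  by_contra hcon
  push Not at hcon
  have hall : ∀ k : ℕ, ∃ S : Finset (Σ x : V, G.Walk x x),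
      (∀ c ∈ S, c.2.IsCycle ∧ Odd c.2.length ∧ c.2.length ≤ 2 * D + 1) ∧
      (∀ c ∈ S, ∀ d ∈ S, c ≠ d → ∀ e ∈ c.2.edges, e ∉ d.2.edges) ∧ S.card = k := by
    intro k
    induction k with
    | zero => exact ⟨∅, by simp, by simp, rfl⟩
    | succ k ih =>
      obtain ⟨S, h1, h2, h3⟩ := ih
      have hlt := hcon S h1 h2
      let A : Finset (Sym2 V) := S.biUnion fun c => c.2.edges.toFinset
      have hAcard : A.card ≤ S.card * (2 * D + 1) := by
        apply Finset.card_biUnion_le_card_mul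
        intro c hc
        refine (List.toFinset_card_le _).trans ?_
        rw [SimpleGraph.Walk.length_edges]
        exact (h1 c hc).2.2
      have hAsub : (A : Set (Sym2 V)) ⊆ G.edgeSet := by
        intro e he
        simp only [A, Finset.mem_coe, Finset.mem_biUnion, List.mem_toFinset] at he
        obtain ⟨c, -, he⟩ := he
        exact c.2.edges_subset_edgeSet he
      obtain ⟨F, hF1, hF2, hF3⟩ := hsub (G.deleteEdges A) (G.deleteEdges_le _)
      have hnc : ¬ ((G.deleteEdges (A : Set (Sym2 V))).deleteEdges (F : Set (Sym2 V))).Colorable 2 := by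
        intro hc
        rw [SimpleGraph.deleteEdges_deleteEdges, ← Finset.coe_union] at hc
        have hlt2 := hfar (A ∪ F) (by
          rw [Finset.coe_union]
          refine Set.union_subset hAsub (hF1.trans ?_)
          exact SimpleGraph.edgeSet_mono (G.deleteEdges_le _)) hc
        have hu : ((A ∪ F).card : ℝ) ≤ A.card + F.card := by
          exact_mod_cast Finset.card_union_le A F
        have hA' : (A.card : ℝ) ≤ S.card * (2 * D + 1) := by exact_mod_cast hAcard
        rw [lt_div_iff₀ (by positivity)] at hlt
        nlinarith
      obtain ⟨x, c, hc1, hc2, hc3⟩ := aux_short _ _ (SimpleGraph.deleteEdges_le _) D hF3 hnc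
      have hle : G.deleteEdges (A : Set (Sym2 V)) ≤ G := G.deleteEdges_le _
      have hedge : (c.mapLe hle).edges = c.edges := by simp
      have hdis : ∀ e ∈ c.edges, ∀ d ∈ S, e ∉ d.2.edges := by
        intro e he d hd hed
        have := c.edges_subset_edgeSet he
        rw [SimpleGraph.edgeSet_deleteEdges] at this
        apply this.2
        simp only [A, Finset.mem_coe, Finset.mem_biUnion, List.mem_toFinset]
        exact ⟨d, hd, hed⟩
      have hnot : (⟨x, c.mapLe hle⟩ : Σ x : V, G.Walk x x) ∉ S := by
        intro hm
        have hne : c.edges ≠ [] := by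
          intro h0
          have h5 := hc1.three_le_length
          rw [← SimpleGraph.Walk.length_edges, h0] at h5
          simp at h5
        obtain ⟨e, he⟩ := List.exists_mem_of_ne_nil _ hne
        exact hdis e he _ hm (by rw [hedge]; exact he)
      refine ⟨insert ⟨x, c.mapLe hle⟩ S, ?_, ?_, ?_⟩
      · intro d hd
        rcases Finset.mem_insert.1 hd with rfl | hd
        · refine ⟨(SimpleGraph.Walk.isCycle_mapLe hle).2 hc1, ?_, ?_⟩
          · simpa using hc2
          · simpa using hc3
        · exact h1 d hd
      · intro a ha b hb hab e hea heb
        rcases Finset.mem_insert.1 ha with rfl | ha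
        · rcases Finset.mem_insert.1 hb with rfl | hb
          · exact hab rfl
          · exact hdis e (hedge ▸ hea) b hb heb
        · rcases Finset.mem_insert.1 hb with rfl | hb
          · exact hdis e (hedge ▸ heb) a ha hea
          · exact h2 a ha b hb hab e hea heb
      · rw [Finset.card_insert_of_notMem hnot, h3]
  obtain ⟨k, hk⟩ := exists_nat_ge (ε * (Fintype.card V : ℝ) / (2 * (2 * D + 1)))
  obtain ⟨S, h1, h2, h3⟩ := hall k
  have := hcon S h1 h2
  rw [h3] at this
  linarith
end

section
/- Let G = (V, E) be a finite simple graph with |E| ≤ 3·|V|. Let C be a finite family of pairwise edge-disjoint cycles in G and set α = |C|/|V| > 0. Then there exists a subfamily C' ⊆ C with |C'| ≥ |C|/2 such that for every vertex v ∈ V, either deg_{G(C')}(v) = 0 or deg_{G(C')}(v) ≥ (α/12)·deg_G(v). -/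
open scoped Classical

/-- For a family `C` of cycles (closed walks) in a graph `G` on vertex set `V`, `G(C)` is the
spanning subgraph of `G` on vertex set `V` whose edge set is the union of the edge sets of the
cycles in `C`. -/
def cyclesGraph {V : Type*} (G : SimpleGraph V) (C : Finset (Σ x : V, G.Walk x x)) :
    SimpleGraph V :=
  SimpleGraph.fromEdgeSet {e | ∃ c ∈ C, e ∈ c.2.edges}

theorem card_through_le {V : Type*} [Fintype V] [DecidableEq V]
    (G : SimpleGraph V) (D : Finset (Σ x : V, G.Walk x x))
    (hcyc : ∀ c ∈ D, c.2.IsCycle)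
    (hdisj : ∀ c ∈ D, ∀ d ∈ D, c ≠ d → ∀ e ∈ c.2.edges, e ∉ d.2.edges) (v : V)
    [Fintype ((cyclesGraph G D).neighborSet v)] :
    (D.filter (fun c => v ∈ c.2.support)).card ≤ (cyclesGraph G D).degree v := by
  have hex : ∀ c : (Σ x : V, G.Walk x x), ∃ w : V,
      c ∈ D.filter (fun c => v ∈ c.2.support) → s(v, w) ∈ c.2.edges := by
    intro c
    by_cases hc : c ∈ D.filter (fun c => v ∈ c.2.support)
    · obtain ⟨hcD, hv⟩ := Finset.mem_filter.1 hc
      have hnil : ¬ c.2.Nil := (hcyc c hcD).not_nil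
      obtain ⟨e, he, hve⟩ := (SimpleGraph.Walk.mem_support_iff_exists_mem_edges_of_not_nil hnil).1 hv
      obtain ⟨w, rfl⟩ := Sym2.mem_iff_exists.1 hve
      exact ⟨w, fun _ => he⟩
    · exact ⟨v, fun h => absurd h hc⟩
  choose f hf using hex
  rw [SimpleGraph.degree]
  apply Finset.card_le_card_of_injOn f
  · intro c hc
    have he := hf c hc
    have hadj := c.2.adj_of_mem_edges he
    rw [Finset.mem_coe, SimpleGraph.mem_neighborFinset, cyclesGraph,
      SimpleGraph.fromEdgeSet_adj]
    exact ⟨⟨c, (Finset.mem_filter.1 hc).1, he⟩, hadj.ne⟩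
  · intro c hc d hd hcd
    by_contra hne
    have h1 := hf c hc
    have h2 := hf d hd
    rw [← hcd] at h2
    exact hdisj c (Finset.mem_filter.1 hc).1 d (Finset.mem_filter.1 hd).1 hne _ h1 h2

/-- Let `G = (V, E)` be a finite simple graph with `|E| ≤ 3|V|`, let `C` be a
finite family of pairwise edge-disjoint cycles in `G`, and set `α = |C|/|V| > 0`. Then there is
a subfamily `C' ⊆ C` with `|C'| ≥ |C|/2` such that every vertex `v` has either degree `0` in
`G(C')` or degree at least `(α/12)·deg_G(v)` in `G(C')`. -/
theorem stmt_8 {V : Type*} [Fintype V] [DecidableEq V]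
    (G : SimpleGraph V) [DecidableRel G.Adj]
    (hE : G.edgeFinset.card ≤ 3 * Fintype.card V)
    (C : Finset (Σ x : V, G.Walk x x))
    (hcyc : ∀ c ∈ C, c.2.IsCycle)
    (hdisj : ∀ c ∈ C, ∀ d ∈ C, c ≠ d → ∀ e ∈ c.2.edges, e ∉ d.2.edges)
    (α : ℝ) (hα : α = (C.card : ℝ) / (Fintype.card V : ℝ)) (hα0 : 0 < α) :
    ∃ C' ⊆ C, (C.card : ℝ) / 2 ≤ (C'.card : ℝ) ∧
      ∀ v : V, (cyclesGraph G C').degree v = 0 ∨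
        α / 12 * (G.degree v : ℝ) ≤ ((cyclesGraph G C').degree v : ℝ) := by
  have hn : (0:ℝ) < Fintype.card V := by
    rcases (Nat.cast_nonneg (α := ℝ) (Fintype.card V)).lt_or_eq with h | h
    · exact h
    · rw [← h] at hα
      simp at hα
      linarith
  let F : Finset V → Finset (Σ x : V, G.Walk x x) :=
    fun S => C.filter (fun c => ∀ v ∈ S, v ∉ c.2.support)
  let P : Finset V → Prop := fun S =>
    (C.card : ℝ) ≤ (F S).card + ∑ v ∈ S, α / 12 * (G.degree v : ℝ)
  have hP0 : P ∅ := by simp [P, F]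
  obtain ⟨S, hS, hmax⟩ := Finset.exists_max_image
    ((Finset.univ : Finset (Finset V)).filter P) Finset.card ⟨∅, by simpa using hP0⟩
  have hPS : P S := by simpa using hS
  refine ⟨F S, Finset.filter_subset _ _, ?_, ?_⟩
  · have h1 : ∑ v ∈ S, α / 12 * (G.degree v : ℝ) ≤ ∑ v : V, α / 12 * (G.degree v : ℝ) :=
      Finset.sum_le_sum_of_subset_of_nonneg (Finset.subset_univ _)
        (fun _ _ _ => by positivity)
    have h2 : ∑ v : V, (G.degree v : ℝ) = 2 * (G.edgeFinset.card : ℝ) := by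
      exact_mod_cast G.sum_degrees_eq_twice_card_edges
    have h3 : (G.edgeFinset.card : ℝ) ≤ 3 * Fintype.card V := by exact_mod_cast hE
    rw [← Finset.mul_sum, ← Finset.mul_sum, h2] at h1
    have h4 : α * Fintype.card V = C.card := by rw [hα]; field_simp
    have h5 : α * (G.edgeFinset.card : ℝ) ≤ α * (3 * Fintype.card V) :=
      mul_le_mul_of_nonneg_left h3 hα0.le
    have h6 : (C.card : ℝ) ≤ (F S).card + ∑ v ∈ S, α / 12 * (G.degree v : ℝ) := hPS
    rw [← Finset.mul_sum] at h6
    linarith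
  · intro v
    by_contra! hcon
    obtain ⟨hd0, hd⟩ := hcon
    have hvS : v ∉ S := by
      intro hvS
      apply hd0
      rw [SimpleGraph.degree, Finset.card_eq_zero, Finset.eq_empty_iff_forall_notMem]
      intro w hw
      rw [SimpleGraph.mem_neighborFinset, cyclesGraph, SimpleGraph.fromEdgeSet_adj] at hw
      obtain ⟨⟨c, hc, he⟩, -⟩ := hw
      exact (Finset.mem_filter.1 hc).2 v hvS (c.2.fst_mem_support_of_mem_edges he)
    have hle : ((F S).filter (fun c => v ∈ c.2.support)).card ≤
        (cyclesGraph G (F S)).degree v :=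
      card_through_le G (F S) (fun c hc => hcyc c (Finset.mem_filter.1 hc).1)
        (fun c hc d hd => hdisj c (Finset.mem_filter.1 hc).1 d (Finset.mem_filter.1 hd).1) v
    have hins : F (insert v S) = (F S).filter (fun c => ¬ v ∈ c.2.support) := by
      ext c
      simp only [F, Finset.mem_filter, Finset.mem_insert, forall_eq_or_imp]
      tauto
    have hsplit := Finset.card_filter_add_card_filter_not (s := F S)
      (fun c => v ∈ c.2.support)
    have hPi : P (insert v S) := by
      change (C.card : ℝ) ≤ (F (insert v S)).card + _
      have h6 : (C.card : ℝ) ≤ (F S).card + ∑ v ∈ S, α / 12 * (G.degree v : ℝ) := hPS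
      rw [hins, Finset.sum_insert hvS]
      have h7 : (((F S).filter (fun c => v ∈ c.2.support)).card : ℝ) ≤
        ((cyclesGraph G (F S)).degree v : ℝ) := by exact_mod_cast hle
      have h8 : (((F S).filter (fun c => v ∈ c.2.support)).card : ℝ) +
        ((F S).filter (fun c => ¬ v ∈ c.2.support)).card = (F S).card := by
        exact_mod_cast hsplit
      linarith
    have := hmax (insert v S) (by simpa using hPi)
    rw [Finset.card_insert_of_notMem hvS] at this
    omega
end

section
/- Let k ≥ 3 be an integer and let C be a finite family of pairwise edge-disjoint cycles, each of length at most k, in a finite simple graph on vertex set V. Assume that for every nonempty subfamily C'' ⊆ C, the graph G(C'') contains a vertex that lies on some cycle of C'' and has at most 6 distinct neighbors in G(C''). Then there exists a subfamily C' ⊆ C with |C'| ≥ |C|/(4k+2) such that every cycle in C' contains a vertex having at most 6 distinct neighbors in G(C'). -/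
open scoped Classical

theorem peel_aux {α V : Type*} [Nonempty V] (s : α → Finset V) (k : ℕ) (n : ℕ) :
    ∀ D : Finset α, D.card ≤ n → (∀ c ∈ D, (s c).card ≤ k) →
    (∀ D' ⊆ D, D'.Nonempty → ∃ v, (∃ c ∈ D', v ∈ s c) ∧ (D'.filter (fun c => v ∈ s c)).card ≤ 3) →
    ∃ R ⊆ D, D.card ≤ 3 * R.card ∧ ∃ (w : α → V) (col : α → ℕ),
      (∀ c ∈ R, col c < k ∧ w c ∈ s c) ∧
      (∀ c ∈ R, ∀ d ∈ R, c ≠ d → w d ∈ s c → col c ≠ col d) ∧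
      (∀ c ∈ R, ∀ d ∈ R, w c = w d → c = d) := by
  induction n with
  | zero =>
    intro D hD _ _
    have : D = ∅ := by simpa using hD
    subst this
    exact ⟨∅, by simp, by simp, fun _ => Classical.arbitrary V, fun _ => 0, by simp, by simp, by simp⟩
  | succ n ih =>
    intro D hD hs hm
    rcases D.eq_empty_or_nonempty with rfl | hne
    · exact ⟨∅, by simp, by simp, fun _ => Classical.arbitrary V, fun _ => 0, by simp, by simp,
        by simp⟩
    obtain ⟨v, ⟨c, hcD, hvc⟩, h3⟩ := hm D subset_rfl hne
    have hsplit := Finset.card_filter_add_card_filter_not (s := D) (fun c => v ∈ s c)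
    have hpos : 0 < (D.filter (fun c => v ∈ s c)).card :=
      Finset.card_pos.2 ⟨c, by simp [hcD, hvc]⟩
    have hsub : D.filter (fun c => ¬ v ∈ s c) ⊆ D := Finset.filter_subset _ _
    obtain ⟨R, hRD, hcard, w, col, h1, h2, h4⟩ := ih (D.filter (fun c => ¬ v ∈ s c)) (by omega)
      (fun c hc => hs c (hsub hc)) (fun D' hD' => hm D' (hD'.trans hsub))
    have hRv : ∀ d ∈ R, v ∉ s d := fun d hd => (Finset.mem_filter.1 (hRD hd)).2
    have hcR : c ∉ R := fun h => hRv c h hvc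
    have hRw : ∀ d ∈ R, w d ≠ v := fun d hd h => hRv d hd (h ▸ (h1 d hd).2)
    have hT : (R.filter (fun d => w d ∈ s c)).card ≤ ((s c).erase v).card := by
      apply Finset.card_le_card_of_injOn w
      · intro d hd
        simp only [Finset.coe_filter, Set.mem_ofPred_eq] at hd
        simp [hd.2, hRw d hd.1]
      · intro a ha b hb hab
        simp only [Finset.coe_filter, Set.mem_ofPred_eq] at ha hb
        exact h4 a ha.1 b hb.1 hab
    rw [Finset.card_erase_of_mem hvc] at hT
    have hscpos : 0 < (s c).card := Finset.card_pos.2 ⟨v, hvc⟩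
    have hsc := hs c hcD
    have hcolcard : ((R.filter (fun d => w d ∈ s c)).image col).card < (Finset.range k).card := by
      have := Finset.card_image_le (s := R.filter (fun d => w d ∈ s c)) (f := col)
      rw [Finset.card_range]; omega
    obtain ⟨a, hak, hac⟩ := Finset.exists_mem_notMem_of_card_lt_card hcolcard
    have hac' : ∀ d ∈ R, w d ∈ s c → col d ≠ a := by
      intro d hd hw h
      exact hac (Finset.mem_image.2 ⟨d, Finset.mem_filter.2 ⟨hd, hw⟩, h⟩)
    have hne' : ∀ d ∈ R, d ≠ c := fun d hd h => hcR (h ▸ hd)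
    refine ⟨insert c R, ?_, ?_, Function.update w c v, Function.update col c a, ?_, ?_, ?_⟩
    · exact Finset.insert_subset hcD (hRD.trans hsub)
    · rw [Finset.card_insert_of_notMem hcR]; omega
    · intro d hd
      rcases Finset.mem_insert.1 hd with rfl | hd
      · simpa using ⟨Finset.mem_range.1 hak, hvc⟩
      · simpa [Function.update_of_ne (hne' d hd)] using h1 d hd
    · intro x hx y hy hxy hw
      rcases Finset.mem_insert.1 hx with hx1 | hx1 <;> rcases Finset.mem_insert.1 hy with hy1 | hy1
      · exact absurd (hx1.trans hy1.symm) hxy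
      · subst hx1
        rw [Function.update_of_ne (hne' y hy1)] at hw ⊢
        rw [Function.update_self]
        exact (hac' y hy1 hw).symm
      · subst hy1
        rw [Function.update_self] at hw
        exact absurd hw (hRv x hx1)
      · rw [Function.update_of_ne (hne' y hy1)] at hw ⊢
        rw [Function.update_of_ne (hne' x hx1)]
        exact h2 x hx1 y hy1 hxy hw
    · intro x hx y hy hw
      rcases Finset.mem_insert.1 hx with hx1 | hx1 <;> rcases Finset.mem_insert.1 hy with hy1 | hy1
      · exact hx1.trans hy1.symm
      · subst hx1
        rw [Function.update_of_ne (hne' y hy1), Function.update_self] at hw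
        exact absurd hw.symm (hRw y hy1)
      · subst hy1
        rw [Function.update_of_ne (hne' x hx1), Function.update_self] at hw
        exact absurd hw (hRw x hx1)
      · rw [Function.update_of_ne (hne' y hy1), Function.update_of_ne (hne' x hx1)] at hw
        exact h4 x hx1 y hy1 hw

theorem degree_cyclesGraph {V : Type*} [Fintype V]
    (G : SimpleGraph V) (D : Finset (Σ x : V, G.Walk x x))
    (hcyc : ∀ c ∈ D, c.2.IsCycle)
    (hdisj : ∀ c ∈ D, ∀ d ∈ D, c ≠ d → ∀ e ∈ c.2.edges, e ∉ d.2.edges) (v : V) :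
    (cyclesGraph G D).degree v = 2 * (D.filter (fun c => v ∈ c.2.support.toFinset)).card := by
  have h : (cyclesGraph G D).neighborFinset v =
      (D.filter (fun c => v ∈ c.2.support.toFinset)).biUnion
        (fun c => (c.2.toSubgraph.neighborSet v).toFinset) := by
    ext u
    rw [SimpleGraph.mem_neighborFinset]
    simp only [cyclesGraph, SimpleGraph.fromEdgeSet_adj,
      Set.mem_ofPred_eq, Finset.mem_biUnion, Finset.mem_filter, List.mem_toFinset,
      Set.mem_toFinset, SimpleGraph.Subgraph.mem_neighborSet,
      SimpleGraph.Walk.adj_toSubgraph_iff_mem_edges]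
    constructor
    · rintro ⟨⟨c, hc, he⟩, -⟩
      exact ⟨c, ⟨hc, c.2.fst_mem_support_of_mem_edges he⟩, he⟩
    · rintro ⟨c, ⟨hc, -⟩, he⟩
      exact ⟨⟨c, hc, he⟩, (c.2.adj_of_mem_edges he).ne⟩
  rw [← SimpleGraph.card_neighborFinset_eq_degree, h, Finset.card_biUnion]
  · rw [Finset.sum_const_nat (m := 2), mul_comm]
    intro c hc
    rw [Finset.mem_filter, List.mem_toFinset] at hc
    rw [← (hcyc c hc.1).ncard_neighborSet_toSubgraph_eq_two hc.2, Set.ncard_eq_toFinset_card']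
  · intro c hc d hd hcd
    rw [Function.onFun, Finset.disjoint_left]
    intro u hu hu'
    simp only [Set.mem_toFinset, SimpleGraph.Subgraph.mem_neighborSet,
      SimpleGraph.Walk.adj_toSubgraph_iff_mem_edges] at hu hu'
    exact hdisj c (Finset.mem_filter.1 hc).1 d (Finset.mem_filter.1 hd).1 hcd _ hu hu'

theorem card_support_cycle {V : Type*} (G : SimpleGraph V) (x : V) (p : G.Walk x x)
    (hp : p.IsCycle) : p.support.toFinset.card ≤ p.length := by
  have h : p.support.toFinset ⊆ p.support.tail.toFinset := by
    intro u hu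
    rw [List.mem_toFinset] at *
    rcases p.mem_support_iff.1 hu with rfl | h
    · exact SimpleGraph.Walk.end_mem_tail_support hp.not_nil
    · exact h
  refine (Finset.card_le_card h).trans ((List.toFinset_card_le _).trans ?_)
  simp

/-- Let `k ≥ 3` and let `C` be a finite family of pairwise edge-disjoint
cycles, each of length at most `k`, in a finite simple graph on vertex set `V`. Assume every
nonempty subfamily `C'' ⊆ C` yields a graph `G(C'')` having a vertex that lies on some cycle of
`C''` and has at most 6 distinct neighbors in `G(C'')`. Then there is a subfamily `C' ⊆ C` with
`|C'| ≥ |C|/(4k+2)` such that every cycle in `C'` contains a vertex having at most 6 distinct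
neighbors in `G(C')`. -/
theorem stmt_9 {V : Type*} [Fintype V] [DecidableEq V]
    (G : SimpleGraph V) (k : ℕ) (hk : 3 ≤ k)
    (C : Finset (Σ x : V, G.Walk x x))
    (hcyc : ∀ c ∈ C, c.2.IsCycle ∧ c.2.length ≤ k)
    (hdisj : ∀ c ∈ C, ∀ d ∈ C, c ≠ d → ∀ e ∈ c.2.edges, e ∉ d.2.edges)
    (hmain : ∀ C'' ⊆ C, C''.Nonempty →
      ∃ v : V, (∃ c ∈ C'', v ∈ c.2.support) ∧ (cyclesGraph G C'').degree v ≤ 6) :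
    ∃ C' ⊆ C, (C.card : ℝ) / (4 * k + 2) ≤ (C'.card : ℝ) ∧
      ∀ c ∈ C', ∃ v ∈ c.2.support, (cyclesGraph G C').degree v ≤ 6 := by
  have hdeg : ∀ D ⊆ C, ∀ v, (cyclesGraph G D).degree v =
      2 * (D.filter (fun c => v ∈ c.2.support.toFinset)).card := fun D hD v => by
    have := degree_cyclesGraph G D (fun c hc => (hcyc c (hD hc)).1)
      (fun c hc d hd => hdisj c (hD hc) d (hD hd)) v
    convert this
  rcases C.eq_empty_or_nonempty with rfl | ⟨c0, hc0⟩
  · exact ⟨∅, by simp, by simp, by simp⟩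
  have : Nonempty V := ⟨c0.1⟩
  obtain ⟨R, hRC, hcard, w, col, h1, h2, -⟩ := peel_aux
    (fun c : (Σ x : V, G.Walk x x) => c.2.support.toFinset) k C.card C le_rfl
    (fun c hc => by
      have := card_support_cycle G c.1 c.2 (hcyc c hc).1
      have h' := (hcyc c hc).2
      refine le_trans (le_of_eq ?_) (this.trans h')
      congr!)
    (fun D hD hne => by
      obtain ⟨v, ⟨c, hc, hv⟩, hd⟩ := hmain D hD hne
      rw [hdeg D hD v] at hd
      refine ⟨v, ⟨c, hc, by simpa using hv⟩, ?_⟩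
      have : (D.filter (fun c => v ∈ c.2.support.toFinset)).card ≤ 3 := by omega
      convert this)
  have hcardR : (C.card : ℝ) ≤ 3 * R.card := by exact_mod_cast hcard
  have hkR : (3 : ℝ) ≤ k := by exact_mod_cast hk
  obtain ⟨a, -, ha⟩ := Finset.exists_le_card_fiber_of_nsmul_le_card_of_maps_to
    (s := R) (t := Finset.range k) (f := col) (b := (C.card : ℝ) / (4 * k + 2))
    (fun c hc => Finset.mem_range.2 (h1 c hc).1) ⟨0, Finset.mem_range.2 (by omega)⟩ (by
      rw [Finset.card_range, nsmul_eq_mul, mul_div_assoc', div_le_iff₀ (by positivity)]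
      have : (0 : ℝ) ≤ R.card := by positivity
      nlinarith [mul_le_mul_of_nonneg_left hcardR (by linarith : (0 : ℝ) ≤ k)])
  have hsub : R.filter (fun c => col c = a) ⊆ C := (Finset.filter_subset _ _).trans hRC
  refine ⟨R.filter (fun c => col c = a), hsub, by convert ha, ?_⟩
  intro c hc
  have hc' := Finset.mem_filter.1 hc
  refine ⟨w c, by simpa using (h1 c hc'.1).2, ?_⟩
  rw [hdeg _ hsub]
  have : ((R.filter (fun c => col c = a)).filter (fun d => w c ∈ d.2.support.toFinset)).card ≤ 1 := by
    rw [← Finset.card_singleton c]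
    apply Finset.card_le_card
    intro d hd
    rw [Finset.mem_filter, Finset.mem_filter] at hd
    rw [Finset.mem_singleton]
    by_contra hne
    exact h2 d hd.1.1 c hc'.1 hne (by simpa using hd.2) (hd.1.2.trans hc'.2.symm)
  omega
end

section
/- Let k ≥ 3 be an integer and let C be a finite family of pairwise edge-disjoint cycles, each of length at most k, in a finite simple graph on vertex set V. Let Q be the set of vertices that have at most 6 distinct neighbors in G(C), and assume that every cycle of C contains at least one vertex of Q. Then there exists a subfamily C' ⊆ C with |C'| ≥ 12^{−2k}·|C| such that every cycle in C' contains a vertex v ∈ Q whose degree in G(C') is exactly 2 (so v has exactly two distinct neighbors in G(C') and lies on exactly one cycle of C'). -/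
open scoped Classical

theorem aux_indep {α : Type*} (R : α → α → Prop) : ∀ (n : ℕ) (C : Finset α), C.card = n →
    (∀ c ∈ C, (C.filter (fun d => d ≠ c ∧ R c d)).card ≤ 2) →
    ∃ S ⊆ C, C.card ≤ 5 * S.card ∧ ∀ c ∈ S, ∀ d ∈ S, d ≠ c → ¬ R c d := by
  intro n
  induction n using Nat.strong_induction_on with
  | _ n ih =>
    intro C hn hC
    rcases C.eq_empty_or_nonempty with rfl | hne
    · exact ⟨∅, by simp⟩
    have hin : ∃ c ∈ C, (C.filter (fun d => d ≠ c ∧ R d c)).card ≤ 2 := by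
      by_contra! hcon
      have h1 : ∑ c ∈ C, (C.filter (fun d => d ≠ c ∧ R d c)).card
          = ∑ c ∈ C, (C.filter (fun d => d ≠ c ∧ R c d)).card := by
        simp only [Finset.card_filter]
        rw [Finset.sum_comm]
        simp only [ne_comm]
      have h2 : ∑ c ∈ C, (C.filter (fun d => d ≠ c ∧ R c d)).card ≤ ∑ c ∈ C, 2 :=
        Finset.sum_le_sum hC
      have h3 : ∑ c ∈ C, 2 < ∑ c ∈ C, (C.filter (fun d => d ≠ c ∧ R d c)).card :=
        Finset.sum_lt_sum_of_nonempty hne hcon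
      omega
    obtain ⟨c, hc, hcin⟩ := hin
    set B := insert c (C.filter (fun d => d ≠ c ∧ R d c) ∪ C.filter (fun d => d ≠ c ∧ R c d))
      with hB
    have hBcard : B.card ≤ 5 := by
      have := hC c hc
      rw [hB]
      have h1 := Finset.card_insert_le c
        (C.filter (fun d => d ≠ c ∧ R d c) ∪ C.filter (fun d => d ≠ c ∧ R c d))
      have h2 := Finset.card_union_le
        (C.filter (fun d => d ≠ c ∧ R d c)) (C.filter (fun d => d ≠ c ∧ R c d))
      omega
    have hcB : c ∈ B := Finset.mem_insert_self _ _
    have hlt : (C \ B).card < C.card := by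
      apply Finset.card_lt_card
      refine ⟨Finset.sdiff_subset, fun h => ?_⟩
      exact (Finset.mem_sdiff.1 (h hc)).2 hcB
    obtain ⟨S, hS, hcard, hind⟩ := ih _ (hn ▸ hlt) (C \ B) rfl (fun d hd =>
      (Finset.card_le_card (Finset.filter_subset_filter _ Finset.sdiff_subset)).trans
        (hC d (Finset.mem_sdiff.1 hd).1))
    have hcS : c ∉ S := fun h => (Finset.mem_sdiff.1 (hS h)).2 hcB
    refine ⟨insert c S, ?_, ?_, ?_⟩
    · intro x hx
      rcases Finset.mem_insert.1 hx with rfl | hx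
      · exact hc
      · exact (Finset.mem_sdiff.1 (hS hx)).1
    · rw [Finset.card_insert_of_notMem hcS]
      have := Finset.le_card_sdiff B C
      omega
    · have key : ∀ x ∈ S, x ∈ C ∧ x ∉ B := fun x hx => Finset.mem_sdiff.1 (hS hx)
      intro x hx y hy hxy hR
      rcases Finset.mem_insert.1 hx with rfl | hx1
      · rcases Finset.mem_insert.1 hy with rfl | hy
        · exact hxy rfl
        · obtain ⟨h1, h2⟩ := key y hy
          apply h2
          simp [hB, h1, hxy, hR]
      · rcases Finset.mem_insert.1 hy with rfl | hy
        · obtain ⟨h1, h2⟩ := key x hx1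
          apply h2
          simp [hB, h1, hxy.symm, hR]
        · exact hind x hx1 y hy hxy hR

theorem aux_deg {V : Type*} [Fintype V] [DecidableEq V]
    (G : SimpleGraph V) (C : Finset (Σ x : V, G.Walk x x))
    (hcyc : ∀ c ∈ C, c.2.IsCycle)
    (hdisj : ∀ c ∈ C, ∀ d ∈ C, c ≠ d → ∀ e ∈ c.2.edges, e ∉ d.2.edges) (v : V) :
    (cyclesGraph G C).degree v = 2 * (C.filter (fun c => v ∈ c.2.support)).card := by
  have h1 : (cyclesGraph G C).neighborFinset v =
      (C.filter (fun c => v ∈ c.2.support)).biUnion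
        (fun c => Finset.univ.filter (fun w => s(v, w) ∈ c.2.edges)) := by
    ext w
    rw [SimpleGraph.mem_neighborFinset]
    simp only [cyclesGraph, SimpleGraph.fromEdgeSet_adj,
      Set.mem_ofPred_eq, Finset.mem_biUnion, Finset.mem_filter, Finset.mem_univ, true_and]
    constructor
    · rintro ⟨⟨c, hc, he⟩, -⟩
      exact ⟨c, ⟨hc, c.2.fst_mem_support_of_mem_edges he⟩, he⟩
    · rintro ⟨c, ⟨hc, -⟩, he⟩
      exact ⟨⟨c, hc, he⟩, (c.2.adj_of_mem_edges he).ne⟩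
  rw [← SimpleGraph.card_neighborFinset_eq_degree, h1, Finset.card_biUnion]
  · rw [Finset.sum_const_nat (m := 2), mul_comm]
    intro c hc
    obtain ⟨hc, hv⟩ := Finset.mem_filter.1 hc
    have := (hcyc c hc).ncard_neighborSet_toSubgraph_eq_two hv
    rw [← this, ← Set.ncard_coe_finset]
    congr 1
    ext w
    rw [SimpleGraph.Subgraph.mem_neighborSet, ← SimpleGraph.Subgraph.mem_edgeSet,
      SimpleGraph.Walk.mem_edges_toSubgraph]
    simp
  · intro c hc d hd hcd
    rw [Function.onFun, Finset.disjoint_left]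
    intro w hw hw'
    simp only [Finset.mem_filter, Finset.coe_filter, Set.mem_ofPred_eq, Finset.mem_univ, true_and] at hc hd hw hw'
    exact hdisj c hc.1 d hd.1 hcd _ hw hw'

/-- Let `k ≥ 3` and let `C` be a finite family of pairwise edge-disjoint
cycles, each of length at most `k`, in a finite simple graph on vertex set `V`. Let `Q` be the
set of vertices with at most 6 distinct neighbors in `G(C)`, and assume every cycle of `C`
contains a vertex of `Q`. Then there is a subfamily `C' ⊆ C` with `|C'| ≥ 12^{-2k}·|C|` such
that every cycle in `C'` contains a vertex `v ∈ Q` whose degree in `G(C')` is exactly `2`. -/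
theorem stmt_10 {V : Type*} [Fintype V] [DecidableEq V]
    (G : SimpleGraph V) (k : ℕ) (hk : 3 ≤ k)
    (C : Finset (Σ x : V, G.Walk x x))
    (hcyc : ∀ c ∈ C, c.2.IsCycle ∧ c.2.length ≤ k)
    (hdisj : ∀ c ∈ C, ∀ d ∈ C, c ≠ d → ∀ e ∈ c.2.edges, e ∉ d.2.edges)
    (Q : Set V) (hQ : Q = {v : V | (cyclesGraph G C).degree v ≤ 6})
    (hcover : ∀ c ∈ C, ∃ v ∈ Q, v ∈ c.2.support) :
    ∃ C' ⊆ C, ((12 : ℝ) ^ (2 * k))⁻¹ * (C.card : ℝ) ≤ (C'.card : ℝ) ∧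
      ∀ c ∈ C', ∃ v ∈ Q, v ∈ c.2.support ∧ (cyclesGraph G C').degree v = 2 := by
  have hc1 : ∀ c ∈ C, c.2.IsCycle := fun c hc => (hcyc c hc).1
  have hq : ∀ c : (Σ x : V, G.Walk x x), ∃ v, c ∈ C → v ∈ Q ∧ v ∈ c.2.support := by
    intro c
    by_cases hc : c ∈ C
    · obtain ⟨v, h1, h2⟩ := hcover c hc
      exact ⟨v, fun _ => ⟨h1, h2⟩⟩
    · exact ⟨c.1, fun h => absurd h hc⟩
  choose q hq using hq
  obtain ⟨S, hS, hcard, hind⟩ := aux_indep (fun c d => q c ∈ d.2.support) _ C rfl (by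
    intro c hc
    obtain ⟨h1, h2⟩ := hq c hc
    rw [hQ, Set.mem_ofPred_eq, aux_deg G C hc1 hdisj] at h1
    have h3 : (C.filter (fun d => d ≠ c ∧ q c ∈ d.2.support)).card
        < (C.filter (fun d => q c ∈ d.2.support)).card := by
      apply Finset.card_lt_card
      refine ⟨fun d hd => ?_, fun h => ?_⟩
      · simp only [Finset.mem_filter] at hd ⊢
        exact ⟨hd.1, hd.2.2⟩
      · have := h (Finset.mem_filter.2 ⟨hc, h2⟩)
        exact (Finset.mem_filter.1 this).2.1 rfl
    have h4 : (C.filter (fun d => d ≠ c ∧ q c ∈ d.2.support)).card ≤ 2 := by omega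
    convert h4)
  refine ⟨S, hS, ?_, ?_⟩
  · have h12 : (5 : ℝ) ≤ 12 ^ (2 * k) := by
      calc (5 : ℝ) ≤ 12 ^ 1 := by norm_num
        _ ≤ 12 ^ (2 * k) := pow_le_pow_right₀ (by norm_num) (by omega)
    rw [inv_mul_le_iff₀ (by positivity)]
    calc (C.card : ℝ) ≤ 5 * S.card := by exact_mod_cast hcard
      _ ≤ _ := by gcongr
  · intro c hc
    obtain ⟨h1, h2⟩ := hq c (hS hc)
    refine ⟨q c, h1, h2, ?_⟩
    rw [aux_deg G S (fun c hc => hc1 c (hS hc))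
      (fun c hc d hd => hdisj c (hS hc) d (hS hd))]
    have : S.filter (fun d => q c ∈ d.2.support) = {c} := by
      ext d
      simp only [Finset.mem_filter, Finset.mem_singleton]
      constructor
      · rintro ⟨hd, hm⟩
        by_contra hne
        exact hind c hc d hd hne hm
      · rintro rfl
        exact ⟨hc, h2⟩
    rw [this]
    simp
end

section
/- Let G be a finite simple graph on vertex set V, let C be a finite family of cycles in G, and let P : V → V be a map satisfying: (i) P(P(u)) = P(u) for every u ∈ V; (ii) P(u) = u for every vertex u that lies on no cycle of C; (iii) for every cycle c ∈ C and every u in the image of P, if some vertex w with P(w) = u lies on c, then u lies on c; (iv) for every cycle c ∈ C and every u in the image of P, the set of vertices of c belonging to P⁻¹(u) is either empty, or consists of all vertices of c, or forms a nonempty set of consecutive vertices along c (i.e., induces a path in c). Then for every u in the image of P, the set P⁻¹(u) is nonempty (it contains u) and the subgraph of G(C) induced on P⁻¹(u) is connected. -/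
/-- The graph consisting of the edges of a single cycle `c`. -/
def cycleGraph {V : Type*} (G : SimpleGraph V) (c : Σ x : V, G.Walk x x) : SimpleGraph V :=
  SimpleGraph.fromEdgeSet {e | e ∈ c.2.edges}

theorem aux_reach {V : Type*} [DecidableEq V] (H : SimpleGraph V) (S : Set V) {a b : V}
    (q : H.Walk a b) (hq : ∀ z ∈ q.support, z ∈ S) {x : V} (hx : x ∈ q.support) :
    (H.induce S).Reachable ⟨a, hq a q.start_mem_support⟩ ⟨x, hq x hx⟩ :=
  ⟨(q.takeUntil x hx).induce S fun z hz => hq z (q.support_takeUntil_subset_support hx hz)⟩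

/-- Let `G` be a finite simple graph on `V`, `C` a finite family of cycles in
`G`, and `P : V → V` a map such that: (i) `P` is idempotent, (ii) `P u = u` for every vertex
`u` lying on no cycle of `C`, (iii) for every cycle `c ∈ C` and every `u` in the image of `P`,
if some vertex of `c` is mapped to `u` by `P`, then `u` lies on `c`, and (iv) for every cycle
`c ∈ C` and `u` in the image of `P`, the set of vertices of `c` mapped to `u` is empty, is all
of `c`'s vertices, or is the support of a path made of edges of `c`. Then for every `u` in the
image of `P`, the class `P⁻¹(u)` contains `u` and the subgraph of `G(C)` induced on `P⁻¹(u)` is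
connected. -/
theorem stmt_11 {V : Type*} [Fintype V] [DecidableEq V]
    (G : SimpleGraph V) (C : Finset (Σ x : V, G.Walk x x))
    (hcyc : ∀ c ∈ C, c.2.IsCycle)
    (P : V → V)
    (h1 : ∀ u : V, P (P u) = P u)
    (h2 : ∀ u : V, (∀ c ∈ C, u ∉ c.2.support) → P u = u)
    (h3 : ∀ c ∈ C, ∀ u ∈ Set.range P, (∃ w ∈ c.2.support, P w = u) → u ∈ c.2.support)
    (h4 : ∀ c ∈ C, ∀ u ∈ Set.range P,
      (∀ x ∈ c.2.support, P x ≠ u) ∨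
      (∀ x ∈ c.2.support, P x = u) ∨
      (∃ (a b : V) (p : (cycleGraph G c).Walk a b), p.IsPath ∧
        ∀ x : V, x ∈ p.support ↔ x ∈ c.2.support ∧ P x = u)) :
    ∀ u ∈ Set.range P, P u = u ∧ ((cyclesGraph G C).induce (P ⁻¹' {u})).Connected := by
  rintro u hu
  have hPu : P u = u := by
    obtain ⟨w, rfl⟩ := hu
    exact h1 w
  refine ⟨hPu, ?_⟩
  have key : ∀ x (hx : P x = u), ((cyclesGraph G C).induce (P ⁻¹' {u})).Reachable
      ⟨u, hPu⟩ ⟨x, hx⟩ := by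
    intro x hx
    by_cases hc : ∀ c ∈ C, x ∉ c.2.support
    · have := h2 x hc
      have hxu : x = u := this.symm.trans hx
      subst hxu
      exact SimpleGraph.Reachable.refl _
    · push Not at hc
      obtain ⟨c, hcC, hxc⟩ := hc
      have huc := h3 c hcC u hu ⟨x, hxc, hx⟩
      have main : ∃ (a b : V) (q : (cyclesGraph G C).Walk a b),
          (∀ z ∈ q.support, z ∈ P ⁻¹' {u}) ∧ x ∈ q.support ∧ u ∈ q.support := by
        rcases h4 c hcC u hu with h | h | ⟨a, b, p, -, hp⟩
        · exact absurd hx (h x hxc)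
        · have ht : ∀ e ∈ c.2.edges, e ∈ (cyclesGraph G C).edgeSet := by
            intro e he
            rw [cyclesGraph, SimpleGraph.edgeSet_fromEdgeSet]
            exact ⟨⟨c, hcC, he⟩, G.not_isDiag_of_mem_edgeSet (c.2.edges_subset_edgeSet he)⟩
          refine ⟨_, _, c.2.transfer _ ht, ?_, ?_, ?_⟩
          · intro z hz
            rw [SimpleGraph.Walk.support_transfer] at hz
            exact h z hz
          · rwa [SimpleGraph.Walk.support_transfer]
          · rwa [SimpleGraph.Walk.support_transfer]
        · have hle : cycleGraph G c ≤ cyclesGraph G C :=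
            SimpleGraph.fromEdgeSet_mono fun e he => ⟨c, hcC, he⟩
          refine ⟨a, b, p.mapLe hle, ?_, ?_, ?_⟩
          · intro z hz
            rw [SimpleGraph.Walk.support_mapLe_eq_support] at hz
            exact ((hp z).1 hz).2
          · rw [SimpleGraph.Walk.support_mapLe_eq_support]
            exact (hp x).2 ⟨hxc, hx⟩
          · rw [SimpleGraph.Walk.support_mapLe_eq_support]
            exact (hp u).2 ⟨huc, hPu⟩
      obtain ⟨a, b, q, hq, hxq, huq⟩ := main
      exact (aux_reach _ _ q hq huq).symm.trans (aux_reach _ _ q hq hxq)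
  haveI : Nonempty (P ⁻¹' {u}) := ⟨⟨u, hPu⟩⟩
  refine SimpleGraph.Connected.mk ?_
  rintro ⟨x, hx⟩ ⟨y, hy⟩
  exact (key x hx).symm.trans (key y hy)
end
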